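/- Let E be a TOM on a finite vertex set V with internal space ℂ^d admitting an overlapping factorization E = (E_L ⊕ I₊)(I₋ ⊕ E_R) with overlap V₀ along a partition V = V₋ ∪ V₀ ∪ V₊. Then for every density ρ supported on the sum of sites S₀ indexed by V₀, one has π(ρ→S₀) = Tr(f_L(1)(f_R(1)(ρ))), where f_{L}(1) = Σ_{n≥1}(𝔸_L)_n and f_R(1) = Σ_{n≥1}(𝔸_R)_n; moreover, if σ := f_R(1)(ρ) ≠ 0 then π(ρ→S₀) = π_L(σ/Tr σ → S₀) · π_R(ρ→S₀). In particular, if S₀ is recurrent for E_L then π(ρ→S₀) = π_R(ρ→S₀) for every density ρ supported on S₀. -/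

import Mathlib

open Matrix Filter
open scoped ComplexOrder ENNReal

namespace QMCTOM

variable {d : ℕ} {V : Type} [Fintype V] [DecidableEq V]

/-- A completely positive map on `M_d(ℂ)`: one admitting a finite Kraus
representation. -/
def IsCPMap (Φ : Matrix (Fin d) (Fin d) ℂ →ₗ[ℂ] Matrix (Fin d) (Fin d) ℂ) : Prop :=
  ∃ (m : ℕ) (B : Fin m → Matrix (Fin d) (Fin d) ℂ),
    ∀ ρ, Φ ρ = ∑ i, B i * ρ * (B i)ᴴ

/-- A transition operator matrix (TOM) supported on a subset `S` of the vertex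
set `V`: a family of CP maps `E i j`, vanishing unless `i, j ∈ S`, whose column
sums over `S` are trace preserving. A TOM on `V` itself corresponds to
`S = Finset.univ`. -/
def IsTOMOn (S : Finset V)
    (E : V → V → (Matrix (Fin d) (Fin d) ℂ →ₗ[ℂ] Matrix (Fin d) (Fin d) ℂ)) : Prop :=
  (∀ i j, IsCPMap (E i j)) ∧
  (∀ i j, (i ∉ S ∨ j ∉ S) → E i j = 0) ∧
  (∀ j ∈ S, ∀ ρ : Matrix (Fin d) (Fin d) ℂ, (∑ i, (E i j) ρ).trace = ρ.trace)

/-- The action of a TOM on block-diagonal operators `(ρ_j)_{j∈V}`: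
`(Eρ)_i = Σ_j E_i^j(ρ_j)`. -/
noncomputable def tomAct
    (E : V → V → (Matrix (Fin d) (Fin d) ℂ →ₗ[ℂ] Matrix (Fin d) (Fin d) ℂ)) :
    (V → Matrix (Fin d) (Fin d) ℂ) →ₗ[ℂ] (V → Matrix (Fin d) (Fin d) ℂ) where
  toFun ρ i := ∑ j, E i j (ρ j)
  map_add' x y := by
    funext i
    simp [map_add, Finset.sum_add_distrib]
  map_smul' c x := by
    funext i
    simp [_root_.map_smul, Finset.smul_sum]

/-- The projection `ℙ₀` of block-diagonal operators zeroing all components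
outside `S`. -/
noncomputable def siteProj (S : Finset V) :
    (V → Matrix (Fin d) (Fin d) ℂ) →ₗ[ℂ] (V → Matrix (Fin d) (Fin d) ℂ) where
  toFun ρ i := if i ∈ S then ρ i else 0
  map_add' x y := by
    funext i
    by_cases h : i ∈ S <;> simp [h]
  map_smul' c x := by
    funext i
    by_cases h : i ∈ S <;> simp [h]

/-- Total trace of a block-diagonal operator. -/
noncomputable def blockTrace (ρ : V → Matrix (Fin d) (Fin d) ℂ) : ℂ :=
  ∑ i, (ρ i).trace

/-- `retA E S n` is `𝔸_{n+1} = ℙ₀ ∘ E ∘ (ℚ₀∘E)^n ∘ ℙ₀`, where `ℙ₀ = siteProj S`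
and `ℚ₀ = id − ℙ₀`. -/
noncomputable def retA
    (E : V → V → (Matrix (Fin d) (Fin d) ℂ →ₗ[ℂ] Matrix (Fin d) (Fin d) ℂ))
    (S : Finset V) (n : ℕ) :
    (V → Matrix (Fin d) (Fin d) ℂ) →ₗ[ℂ] (V → Matrix (Fin d) (Fin d) ℂ) :=
  (siteProj S) ∘ₗ (tomAct E) ∘ₗ
    (((LinearMap.id - siteProj S) ∘ₗ tomAct E) ^ n) ∘ₗ (siteProj S)

/-- A density supported on the sum of sites indexed by `S`. -/
def DensityOn (S : Finset V) (ρ : V → Matrix (Fin d) (Fin d) ℂ) : Prop :=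
  (∀ j, (ρ j).PosSemidef) ∧ (∀ j ∉ S, ρ j = 0) ∧ blockTrace ρ = 1

/-- Return probability `π(ρ→S₀) = Σ_{n≥1} Tr(𝔸_n(ρ))`. -/
noncomputable def returnProb
    (E : V → V → (Matrix (Fin d) (Fin d) ℂ →ₗ[ℂ] Matrix (Fin d) (Fin d) ℂ))
    (S : Finset V) (ρ : V → Matrix (Fin d) (Fin d) ℂ) : ℝ :=
  ∑' n : ℕ, (blockTrace ((retA E S n) ρ)).re

/-- Expected return time `τ(ρ→S₀) = Σ_{n≥1} n·Tr(𝔸_n(ρ))` if `π(ρ→S₀) = 1`,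
and `∞` otherwise. -/
noncomputable def expReturnTime
    (E : V → V → (Matrix (Fin d) (Fin d) ℂ →ₗ[ℂ] Matrix (Fin d) (Fin d) ℂ))
    (S : Finset V) (ρ : V → Matrix (Fin d) (Fin d) ℂ) : ℝ≥0∞ :=
  if returnProb E S ρ = 1 then
    ∑' n : ℕ, ENNReal.ofReal ((n + 1) * (blockTrace ((retA E S n) ρ)).re)
  else ⊤

/-- The sum of sites `S` is recurrent for `E`. -/
def RecurrentOn
    (E : V → V → (Matrix (Fin d) (Fin d) ℂ →ₗ[ℂ] Matrix (Fin d) (Fin d) ℂ))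
    (S : Finset V) : Prop :=
  ∀ ρ, DensityOn S ρ → returnProb E S ρ = 1

/-- The sum of sites `S` is positive recurrent for `E`. -/
def PosRecurrentOn
    (E : V → V → (Matrix (Fin d) (Fin d) ℂ →ₗ[ℂ] Matrix (Fin d) (Fin d) ℂ))
    (S : Finset V) : Prop :=
  ∀ ρ, DensityOn S ρ → expReturnTime E S ρ < ⊤


/-- Extension of a (zero-extended) TOM by the identity on the sites in `S`:
the matrix of maps `E ⊕ I_S` with entries `E i j` plus the identity on the
diagonal entries indexed by `S`. -/
noncomputable def extById (S : Finset V)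
    (E : V → V → (Matrix (Fin d) (Fin d) ℂ →ₗ[ℂ] Matrix (Fin d) (Fin d) ℂ)) :
    V → V → (Matrix (Fin d) (Fin d) ℂ →ₗ[ℂ] Matrix (Fin d) (Fin d) ℂ) :=
  fun i j => E i j + (if i = j ∧ i ∈ S then LinearMap.id else 0)

set_option linter.unusedSectionVars false

/-- The total trace as a linear functional. -/
noncomputable def blockTraceₗ : (V → Matrix (Fin d) (Fin d) ℂ) →ₗ[ℂ] ℂ where
  toFun := blockTrace
  map_add' x y := by simp [blockTrace, Finset.sum_add_distrib]
  map_smul' c x := by simp [blockTrace, Finset.mul_sum]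

/-- A block-diagonal operator all of whose blocks are positive semidefinite. -/
def BlockPos (ρ : V → Matrix (Fin d) (Fin d) ℂ) : Prop :=
  ∀ j, (ρ j).PosSemidef

/-- The step `ℚ₀ ∘ E`: evolve by `E`, then discard the components in `T`. -/
noncomputable def offSiteStep
    (E : V → V → (Matrix (Fin d) (Fin d) ℂ →ₗ[ℂ] Matrix (Fin d) (Fin d) ℂ)) (T : Finset V) :
    Module.End ℂ (V → Matrix (Fin d) (Fin d) ℂ) :=
  (1 - siteProj T) * tomAct E

/-- In a ring, the first-return coefficients of an overlapping product are the Cauchy product of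
those of its factors. -/
theorem first_return_eq_sum_antidiagonal {A : Type*} [Ring A] {P E L R : A}
    (hP : P * P = P) (hL : E * ((1 - P) * L) = L * ((1 - P) * L))
    (h1 : E * P = L * P * R * P + (1 - P) * R * P)
    (h2 : E * ((1 - P) * R) = L * P * R * ((1 - P) * R) + (1 - P) * R * ((1 - P) * R)) (n : ℕ) :
    P * (E * (((1 - P) * E) ^ n * P)) =
      ∑ p ∈ Finset.HasAntidiagonal.antidiagonal n, P * (L * (((1 - P) * L) ^ p.1 * P)) *
        (P * (R * (((1 - P) * R) ^ p.2 * P))) := by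
  set Q := 1 - P with hQ
  have hQQ : Q * Q = Q := by simp [hQ, mul_sub, sub_mul, hP]
  have hPQ : P * Q = 0 := by simp [hQ, mul_sub, hP]
  have hER (n : ℕ) : E * ((Q * R) ^ n * P) =
      L * P * R * ((Q * R) ^ n * P) + Q * R * ((Q * R) ^ n * P) := by
    cases n with
    | zero => simpa [mul_assoc] using h1
    | succ k =>
      rw [pow_succ', mul_assoc (Q * R), ← mul_assoc E, h2]
      simp only [add_mul, mul_assoc]
  have key (n : ℕ) : E * ((Q * E) ^ n * P) = Q * R * ((Q * R) ^ n * P) +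
      ∑ p ∈ Finset.HasAntidiagonal.antidiagonal n,
        L * ((Q * L) ^ p.1 * (P * (R * ((Q * R) ^ p.2 * P)))) := by
    induction n with
    | zero => simpa [mul_assoc, add_comm] using h1
    | succ k ih =>
      have hw : (Q * E) ^ (k + 1) * P = (Q * R) ^ (k + 1) * P +
          ∑ p ∈ Finset.HasAntidiagonal.antidiagonal k,
            Q * L * ((Q * L) ^ p.1 * (P * (R * ((Q * R) ^ p.2 * P)))) := by
        rw [pow_succ', mul_assoc (Q * E), mul_assoc Q, ih, mul_add, Finset.mul_sum, pow_succ']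
        simp only [← mul_assoc, hQQ]
      rw [hw, mul_add, hER, Finset.mul_sum, Finset.Nat.sum_antidiagonal_succ]
      have : ∀ x, E * (Q * L * x) = L * (Q * L * x) := fun x => by
        rw [← mul_assoc E, hL, mul_assoc]
      simp only [this]
      simp only [pow_succ', pow_zero, one_mul, mul_assoc]
      abel
  rw [key, mul_add, Finset.mul_sum]
  have h0 : P * (Q * R * ((Q * R) ^ n * P)) = 0 := by simp only [← mul_assoc, hPQ, zero_mul]
  rw [h0, zero_add]
  refine Finset.sum_congr rfl fun p _ => ?_
  have : ∀ x, P * (P * x) = P * x := fun x => by rw [← mul_assoc, hP]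
  simp only [mul_assoc, this]

theorem tomAct_apply (E : V → V → (Matrix (Fin d) (Fin d) ℂ →ₗ[ℂ] Matrix (Fin d) (Fin d) ℂ))
    (x : V → Matrix (Fin d) (Fin d) ℂ) (i : V) : tomAct E x i = ∑ j, E i j (x j) := rfl

theorem siteProj_apply (S : Finset V) (x : V → Matrix (Fin d) (Fin d) ℂ) (i : V) :
    siteProj S x i = if i ∈ S then x i else 0 := rfl

theorem siteProj_mul_siteProj (S T : Finset V) :
    (siteProj S * siteProj T : Module.End ℂ (V → Matrix (Fin d) (Fin d) ℂ)) =
      siteProj (S ∩ T) := by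
  refine LinearMap.ext fun x => funext fun i => ?_
  simp only [Module.End.mul_apply, siteProj_apply, Finset.mem_inter]
  split_ifs <;> simp_all

theorem siteProj_empty :
    (siteProj ∅ : Module.End ℂ (V → Matrix (Fin d) (Fin d) ℂ)) = 0 := by
  refine LinearMap.ext fun x => funext fun i => ?_
  simp [siteProj_apply]

theorem tomAct_extById (S : Finset V)
    (E : V → V → (Matrix (Fin d) (Fin d) ℂ →ₗ[ℂ] Matrix (Fin d) (Fin d) ℂ)) :
    tomAct (extById S E) = tomAct E + siteProj S := by
  refine LinearMap.ext fun x => funext fun i => ?_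
  simp only [tomAct_apply, LinearMap.add_apply, Pi.add_apply, siteProj_apply, extById,
    Finset.sum_add_distrib]
  congr 1
  rw [Finset.sum_eq_single i]
  · by_cases h : i ∈ S <;> simp [h]
  · intro j _ hj
    simp [hj.symm]
  · simp

theorem IsTOMOn.siteProj_mul_tomAct {S T : Finset V}
    {E : V → V → (Matrix (Fin d) (Fin d) ℂ →ₗ[ℂ] Matrix (Fin d) (Fin d) ℂ)}
    (hE : IsTOMOn S E) (hST : Disjoint S T) : siteProj T * tomAct E = 0 := by
  refine LinearMap.ext fun x => funext fun i => ?_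
  simp only [Module.End.mul_apply, siteProj_apply, tomAct_apply, LinearMap.zero_apply,
    Pi.zero_apply]
  split_ifs with h
  · exact Finset.sum_eq_zero fun j _ => by
      rw [hE.2.1 i j (Or.inl fun hi => Finset.disjoint_left.1 hST hi h), LinearMap.zero_apply]
  · rfl

theorem IsTOMOn.tomAct_mul_siteProj {S T : Finset V}
    {E : V → V → (Matrix (Fin d) (Fin d) ℂ →ₗ[ℂ] Matrix (Fin d) (Fin d) ℂ)}
    (hE : IsTOMOn S E) (hST : Disjoint S T) : tomAct E * siteProj T = 0 := by
  refine LinearMap.ext fun x => funext fun i => ?_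
  simp only [Module.End.mul_apply, siteProj_apply, tomAct_apply, LinearMap.zero_apply,
    Pi.zero_apply]
  refine Finset.sum_eq_zero fun j _ => ?_
  split_ifs with h
  · rw [hE.2.1 i j (Or.inr fun hi => Finset.disjoint_left.1 hST hi h), LinearMap.zero_apply]
  · simp

theorem retA_eq_mul (E : V → V → (Matrix (Fin d) (Fin d) ℂ →ₗ[ℂ] Matrix (Fin d) (Fin d) ℂ))
    (S : Finset V) (n : ℕ) :
    retA E S n = siteProj S * (tomAct E * (((1 - siteProj S) * tomAct E) ^ n * siteProj S)) :=
  rfl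

theorem one_sub_siteProj {S T : Finset V} (hST : Disjoint S T) (h : S ∪ T = Finset.univ) :
    (1 - siteProj S : Module.End ℂ (V → Matrix (Fin d) (Fin d) ℂ)) = siteProj T := by
  refine LinearMap.ext fun x => funext fun i => ?_
  have hi : i ∈ S ∪ T := h ▸ Finset.mem_univ i
  simp only [LinearMap.sub_apply, Module.End.one_apply, Pi.sub_apply, siteProj_apply]
  by_cases hS : i ∈ S
  · simp [hS, Finset.disjoint_left.1 hST hS]
  · simp [hS, (Finset.mem_union.1 hi).resolve_left hS]

theorem siteProj_union {S T : Finset V} (hST : Disjoint S T) :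
    (siteProj (S ∪ T) : Module.End ℂ (V → Matrix (Fin d) (Fin d) ℂ)) =
      siteProj S + siteProj T := by
  refine LinearMap.ext fun x => funext fun i => ?_
  simp only [LinearMap.add_apply, Pi.add_apply, siteProj_apply, Finset.mem_union]
  by_cases hS : i ∈ S
  · simp [hS, Finset.disjoint_left.1 hST hS]
  · simp [hS]

/-- The return coefficients of an overlapping factorization are the Cauchy product of the return
coefficients of the factors. -/
theorem retA_eq_sum_antidiagonal {Vm V0 Vp : Finset V}
    (hd1 : Disjoint Vm V0) (hd2 : Disjoint V0 Vp) (hd3 : Disjoint Vm Vp)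
    (hcover : Vm ∪ V0 ∪ Vp = Finset.univ)
    {E EL ER : V → V → (Matrix (Fin d) (Fin d) ℂ →ₗ[ℂ] Matrix (Fin d) (Fin d) ℂ)}
    (hL : IsTOMOn (Vm ∪ V0) EL) (hR : IsTOMOn (V0 ∪ Vp) ER)
    (hfac : tomAct E = (tomAct (extById Vp EL)) ∘ₗ (tomAct (extById Vm ER))) (n : ℕ) :
    retA E V0 n = ∑ p ∈ Finset.HasAntidiagonal.antidiagonal n, retA EL V0 p.1 * retA ER V0 p.2 := by
  simp only [retA_eq_mul]
  have hQ : (1 - siteProj V0 : Module.End ℂ (V → Matrix (Fin d) (Fin d) ℂ)) =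
      siteProj Vm + siteProj Vp := by
    rw [← siteProj_union hd3]
    refine one_sub_siteProj (Finset.disjoint_union_right.2 ⟨hd1.symm, hd2⟩) ?_
    rw [← hcover, ← Finset.union_assoc, Finset.union_comm V0 Vm]
  have hdisj {S T : Finset V} (h : Disjoint S T) :
      (siteProj S * siteProj T : Module.End ℂ (V → Matrix (Fin d) (Fin d) ℂ)) = 0 := by
    rw [siteProj_mul_siteProj, Finset.disjoint_iff_inter_eq_empty.1 h, siteProj_empty]
  have hidem (S : Finset V) :
      (siteProj S * siteProj S : Module.End ℂ (V → Matrix (Fin d) (Fin d) ℂ)) = siteProj S := by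
    rw [siteProj_mul_siteProj, Finset.inter_self]
  have hLp := Finset.disjoint_union_left.2 ⟨hd3, hd2⟩
  have hRm := Finset.disjoint_union_left.2 ⟨hd1.symm, hd3.symm⟩
  have pL := hL.siteProj_mul_tomAct hLp
  have Lp := hL.tomAct_mul_siteProj hLp
  have mR := hR.siteProj_mul_tomAct hRm
  have Rm := hR.tomAct_mul_siteProj hRm
  have hfac' : tomAct E = (tomAct EL + siteProj Vp) * (tomAct ER + siteProj Vm) := by
    rw [hfac, tomAct_extById, tomAct_extById]; rfl
  have m0 := hdisj hd1
  have pm := hdisj hd3.symm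
  have hone : (1 : Module.End ℂ (V → Matrix (Fin d) (Fin d) ℂ)) =
      siteProj V0 + (siteProj Vm + siteProj Vp) := by rw [← hQ]; abel
  have hRsplit : tomAct ER = siteProj V0 * tomAct ER + siteProj Vp * tomAct ER := by
    conv_lhs => rw [← one_mul (tomAct ER), hone, add_mul, add_mul, mR, zero_add]
  have hLR : tomAct EL * tomAct ER = tomAct EL * (siteProj V0 * tomAct ER) := by
    conv_lhs => rw [hRsplit]
    rw [mul_add, ← mul_assoc _ (siteProj Vp), Lp, zero_mul, add_zero]
  refine first_return_eq_sum_antidiagonal (hidem V0) ?_ ?_ ?_ n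
  · rw [hQ, add_mul, pL, add_zero, hfac', ← mul_assoc, mul_assoc _ _ (siteProj Vm),
      add_mul _ _ (siteProj Vm), Rm, hidem, zero_add, add_mul, pm, add_zero, mul_assoc]
  · rw [hQ, hfac', add_mul (siteProj Vm), mR, zero_add, mul_assoc, add_mul _ _ (siteProj V0), m0,
      add_zero, add_mul, ← mul_assoc, hLR]
    simp only [mul_assoc]
  · rw [hQ, add_mul (siteProj Vm), mR, zero_add, hfac', mul_assoc,
      add_mul _ _ (siteProj Vp * tomAct ER), ← mul_assoc (siteProj Vm), hdisj hd3, zero_mul,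
      add_zero, add_mul, ← mul_assoc (tomAct EL), hLR]
    simp only [mul_assoc]

theorem _root_.Matrix.PosSemidef.norm_apply_le_trace_re {n : Type*} [Fintype n] [DecidableEq n]
    {A : Matrix n n ℂ} (hA : A.PosSemidef) (i j : n) : ‖A i j‖ ≤ A.trace.re := by
  have hdiag (k : n) : 0 ≤ (A k k).re := (Complex.nonneg_iff.1 hA.diag_nonneg).1
  have hle (k : n) : (A k k).re ≤ A.trace.re := by
    simp only [Matrix.trace, Matrix.diag_apply, Complex.re_sum]
    exact Finset.single_le_sum (f := fun k => (A k k).re) (fun k _ => hdiag k) (Finset.mem_univ k)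
  have hdet := (Complex.nonneg_iff.1 (hA.submatrix ![i, j]).det_nonneg).1
  have hij : A j i = star (A i j) := (hA.isHermitian.apply j i).symm
  have hi := (Complex.nonneg_iff.1 (hA.diag_nonneg (i := i))).2
  rw [Matrix.det_fin_two] at hdet
  simp only [Matrix.submatrix_apply, Matrix.cons_val_zero, Matrix.cons_val_one, hij,
    Complex.sub_re, Complex.mul_re, Complex.star_def, Complex.conj_re, Complex.conj_im,
    ← hi] at hdet
  have hsq : ‖A i j‖ ^ 2 ≤ A.trace.re ^ 2 := by
    rw [← Complex.normSq_eq_norm_sq, Complex.normSq_apply]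
    nlinarith [mul_le_mul (hle i) (hle j) (hdiag j) ((hdiag i).trans (hle i))]
  exact le_of_sq_le_sq hsq ((hdiag i).trans (hle i))

namespace BlockPos

theorem blockTrace_nonneg {x : V → Matrix (Fin d) (Fin d) ℂ} (hx : BlockPos x) :
    0 ≤ blockTrace x :=
  Finset.sum_nonneg fun j _ => (hx j).trace_nonneg

theorem blockTrace_re_nonneg {x : V → Matrix (Fin d) (Fin d) ℂ} (hx : BlockPos x) :
    0 ≤ (blockTrace x).re :=
  (Complex.nonneg_iff.1 hx.blockTrace_nonneg).1

theorem eq_zero_of_blockTrace {x : V → Matrix (Fin d) (Fin d) ℂ} (hx : BlockPos x)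
    (h : blockTrace x = 0) : x = 0 := by
  funext j
  exact (hx j).trace_eq_zero_iff.1
    ((Finset.sum_eq_zero_iff_of_nonneg fun j _ => (hx j).trace_nonneg).1 h j (Finset.mem_univ j))

theorem norm_apply_le {x : V → Matrix (Fin d) (Fin d) ℂ} (hx : BlockPos x) (k : V)
    (i j : Fin d) : ‖x k i j‖ ≤ (blockTrace x).re := by
  refine ((hx k).norm_apply_le_trace_re i j).trans ?_
  rw [blockTrace, Complex.re_sum]
  exact Finset.single_le_sum (f := fun k => (x k).trace.re)
    (fun k _ => (Complex.nonneg_iff.1 (hx k).trace_nonneg).1) (Finset.mem_univ k)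

theorem siteProj {x : V → Matrix (Fin d) (Fin d) ℂ} (hx : BlockPos x) (S : Finset V) :
    BlockPos (siteProj S x) := fun i => by
  rw [siteProj_apply]
  split_ifs
  exacts [hx i, .zero]

theorem one_sub_siteProj {x : V → Matrix (Fin d) (Fin d) ℂ} (hx : BlockPos x) (S : Finset V) :
    BlockPos ((1 - QMCTOM.siteProj S : Module.End ℂ (V → Matrix (Fin d) (Fin d) ℂ)) x) := by
  rw [QMCTOM.one_sub_siteProj disjoint_compl_right (Finset.union_compl S)]
  exact hx.siteProj _

theorem tomAct {S : Finset V}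
    {E : V → V → (Matrix (Fin d) (Fin d) ℂ →ₗ[ℂ] Matrix (Fin d) (Fin d) ℂ)} (hE : IsTOMOn S E)
    {x : V → Matrix (Fin d) (Fin d) ℂ} (hx : BlockPos x) : BlockPos (tomAct E x) := fun i => by
  rw [tomAct_apply]
  refine Matrix.posSemidef_sum _ fun j _ => ?_
  obtain ⟨m, B, hB⟩ := hE.1 i j
  rw [hB]
  exact Matrix.posSemidef_sum _ fun k _ => (hx j).mul_mul_conjTranspose_same (B k)

theorem pow_apply {S T : Finset V}
    {E : V → V → (Matrix (Fin d) (Fin d) ℂ →ₗ[ℂ] Matrix (Fin d) (Fin d) ℂ)} (hE : IsTOMOn S E)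
    {x : V → Matrix (Fin d) (Fin d) ℂ} (hx : BlockPos x) (n : ℕ) :
    BlockPos ((offSiteStep E T ^ n) x) := by
  induction n with
  | zero => simpa using hx
  | succ k ih =>
    rw [pow_succ']
    exact (ih.tomAct hE).one_sub_siteProj T

theorem retA {S T : Finset V}
    {E : V → V → (Matrix (Fin d) (Fin d) ℂ →ₗ[ℂ] Matrix (Fin d) (Fin d) ℂ)} (hE : IsTOMOn S E)
    {x : V → Matrix (Fin d) (Fin d) ℂ} (hx : BlockPos x) (n : ℕ) : BlockPos (retA E T n x) :=
  (((hx.siteProj T).pow_apply hE n).tomAct hE).siteProj T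

theorem tsum {f : ℕ → V → Matrix (Fin d) (Fin d) ℂ} (hf : ∀ n, BlockPos (f n))
    (hs : Summable f) : BlockPos (∑' n, f n) := fun j => by
  have hj : Tendsto (fun N => ∑ n ∈ Finset.range N, f n j) atTop (nhds ((∑' n, f n) j)) := by
    simpa [Finset.sum_apply] using (tendsto_pi_nhds.1 hs.hasSum.tendsto_sum_nat j)
  have hps (N : ℕ) : (∑ n ∈ Finset.range N, f n j).PosSemidef :=
    Matrix.posSemidef_sum _ fun n _ => hf n j
  refine Matrix.posSemidef_iff_dotProduct_mulVec.2 ⟨?_, fun v => ?_⟩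
  · have hstar := (continuous_id.matrix_conjTranspose.tendsto _).comp hj
    exact tendsto_nhds_unique (hstar.congr fun N => (hps N).isHermitian) hj
  · have hc : Continuous fun A : Matrix (Fin d) (Fin d) ℂ => star v ⬝ᵥ (A *ᵥ v) := by fun_prop
    exact ge_of_tendsto' ((hc.tendsto _).comp hj) fun N => (hps N).dotProduct_mulVec_nonneg v

end BlockPos

theorem IsTOMOn.blockTrace_tomAct {S : Finset V}
    {E : V → V → (Matrix (Fin d) (Fin d) ℂ →ₗ[ℂ] Matrix (Fin d) (Fin d) ℂ)} (hE : IsTOMOn S E)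
    {x : V → Matrix (Fin d) (Fin d) ℂ} (hx : ∀ j ∉ S, x j = 0) :
    blockTrace (tomAct E x) = blockTrace x := by
  simp only [blockTrace, tomAct_apply, Matrix.trace_sum]
  rw [Finset.sum_comm]
  refine Finset.sum_congr rfl fun j _ => ?_
  by_cases hj : j ∈ S
  · rw [← Matrix.trace_sum, hE.2.2 j hj]
  · simp [hx j hj]

theorem blockTrace_retA_sum {S T : Finset V} (hTS : T ⊆ S)
    {E : V → V → (Matrix (Fin d) (Fin d) ℂ →ₗ[ℂ] Matrix (Fin d) (Fin d) ℂ)} (hE : IsTOMOn S E)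
    (x : V → Matrix (Fin d) (Fin d) ℂ) (N : ℕ) :
    ∑ n ∈ Finset.range N, blockTrace (retA E T n x) +
      blockTrace ((offSiteStep E T ^ N) (siteProj T x)) =
        blockTrace (siteProj T x) := by
  induction N with
  | zero => simp
  | succ N ih =>
    have hsupp : ∀ j ∉ S, (offSiteStep E T ^ N) (siteProj T x) j = 0 := by
      intro j hj
      cases N with
      | zero => simp [siteProj_apply, show j ∉ T from fun h => hj (hTS h)]
      | succ k =>
        rw [pow_succ', offSiteStep, one_sub_siteProj disjoint_compl_right (Finset.union_compl T)]
        simp only [Module.End.mul_apply, siteProj_apply, tomAct_apply]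
        split_ifs
        · exact Finset.sum_eq_zero fun i _ => by rw [hE.2.1 j i (Or.inl hj)]; rfl
        · rfl
    rw [← ih, Finset.sum_range_succ, add_assoc]
    congr 1
    rw [← hE.blockTrace_tomAct hsupp, pow_succ', Module.End.mul_apply, offSiteStep,
      Module.End.mul_apply, LinearMap.sub_apply, Module.End.one_apply]
    change blockTraceₗ _ + blockTraceₗ _ = blockTraceₗ _
    rw [← map_add, retA_eq_mul]
    simp only [Module.End.mul_apply]
    rw [add_sub_cancel]

theorem sum_blockTrace_retA_le {S T : Finset V} (hTS : T ⊆ S)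
    {E : V → V → (Matrix (Fin d) (Fin d) ℂ →ₗ[ℂ] Matrix (Fin d) (Fin d) ℂ)} (hE : IsTOMOn S E)
    {x : V → Matrix (Fin d) (Fin d) ℂ} (hx : BlockPos x) (hxT : ∀ j ∉ T, x j = 0) (N : ℕ) :
    ∑ n ∈ Finset.range N, (blockTrace (retA E T n x)).re ≤ (blockTrace x).re := by
  have h := congrArg Complex.re (blockTrace_retA_sum hTS hE x N)
  have hT : siteProj T x = x := by
    funext j
    by_cases hj : j ∈ T <;> simp [siteProj_apply, hj, hxT]
  rw [hT, Complex.add_re, Complex.re_sum] at h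
  linarith [(hx.pow_apply (T := T) hE N).blockTrace_re_nonneg]

theorem summable_retA {S T : Finset V} (hTS : T ⊆ S)
    {E : V → V → (Matrix (Fin d) (Fin d) ℂ →ₗ[ℂ] Matrix (Fin d) (Fin d) ℂ)} (hE : IsTOMOn S E)
    {x : V → Matrix (Fin d) (Fin d) ℂ} (hx : BlockPos x) (hxT : ∀ j ∉ T, x j = 0) :
    Summable fun n => retA E T n x := by
  have hs := summable_of_sum_range_le (fun n => (hx.retA (T := T) hE n).blockTrace_re_nonneg)
    (sum_blockTrace_retA_le hTS hE hx hxT)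
  refine Pi.summable.2 fun k => Pi.summable.2 fun i => Pi.summable.2 fun j => ?_
  exact hs.of_norm_bounded fun n => (hx.retA hE n).norm_apply_le k i j

theorem hasSum_blockTrace_re {f : ℕ → V → Matrix (Fin d) (Fin d) ℂ} (hf : Summable f) :
    HasSum (fun n => (blockTrace (f n)).re) (blockTrace (∑' n, f n)).re :=
  Complex.hasSum_re
    (hf.hasSum.map blockTraceₗ (LinearMap.continuous_of_finiteDimensional blockTraceₗ))

theorem tsum_sum_antidiagonal_of_nonneg {t : ℕ → ℕ → ℝ} {c : ℕ → ℝ} (ht : ∀ a b, 0 ≤ t a b)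
    (hle : ∀ b N, ∑ a ∈ Finset.range N, t a b ≤ c b) (hc : Summable c) :
    ∑' n, ∑ p ∈ Finset.HasAntidiagonal.antidiagonal n, t p.1 p.2 = ∑' a, ∑' b, t a b := by
  have hs (b : ℕ) : Summable fun a => t a b := summable_of_sum_range_le (ht · b) (hle b)
  have hprod : Summable fun p : ℕ × ℕ => t p.2 p.1 :=
    (summable_prod_of_nonneg fun p => ht p.2 p.1).2
      ⟨hs, hc.of_nonneg_of_le (fun b => tsum_nonneg (ht · b))
        fun b => (hs b).tsum_le_of_sum_range_le (hle b)⟩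
  have hprod' : Summable fun p : ℕ × ℕ => t p.1 p.2 := hprod.prod_symm
  rw [← hprod'.tsum_prod,
    ← Finset.HasAntidiagonal.sigmaAntidiagonalEquivProd.tsum_eq (fun p : ℕ × ℕ => t p.1 p.2)]
  have hsig := Finset.HasAntidiagonal.sigmaAntidiagonalEquivProd.summable_iff.2 hprod'
  refine Eq.trans ?_ (hsig.tsum_sigma' fun n => (hasSum_fintype _).summable).symm
  refine tsum_congr fun n => ?_
  rw [tsum_fintype, ← Finset.sum_finset_coe]
  rfl

theorem retA_apply_of_notMem
    (E : V → V → (Matrix (Fin d) (Fin d) ℂ →ₗ[ℂ] Matrix (Fin d) (Fin d) ℂ))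
    {S : Finset V} (n : ℕ) (x : V → Matrix (Fin d) (Fin d) ℂ) {j : V} (hj : j ∉ S) :
    retA E S n x j = 0 := by
  simp [retA, siteProj_apply, hj]

theorem returnProb_smul (E : V → V → (Matrix (Fin d) (Fin d) ℂ →ₗ[ℂ] Matrix (Fin d) (Fin d) ℂ))
    (S : Finset V) (r : ℝ) (x : V → Matrix (Fin d) (Fin d) ℂ) :
    returnProb E S ((r : ℂ) • x) = r * returnProb E S x := by
  rw [returnProb, returnProb, ← tsum_mul_left]
  refine tsum_congr fun n => ?_
  change (blockTraceₗ _).re = r * (blockTraceₗ _).re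
  rw [_root_.map_smul, _root_.map_smul, smul_eq_mul, Complex.re_ofReal_mul]

/-- Factorization rule for the return probability: if a TOM `E`
has an overlapping factorization `E = (E_L ⊕ I₊)(I₋ ⊕ E_R)` with overlap `V₀`,
then for every density `ρ` supported on `S₀`: `π(ρ→S₀) = Tr(f_L(1)(f_R(1)(ρ)))`;
if `σ = f_R(1)(ρ) ≠ 0` then `π(ρ→S₀) = π_L(σ/Tr σ → S₀)·π_R(ρ→S₀)`; and if `S₀`
is recurrent for `E_L` then `π(ρ→S₀) = π_R(ρ→S₀)`. -/
theorem tom_factorization_return_probability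
    (Vm V0 Vp : Finset V)
    (hd1 : Disjoint Vm V0) (hd2 : Disjoint V0 Vp) (hd3 : Disjoint Vm Vp)
    (hcover : Vm ∪ V0 ∪ Vp = Finset.univ)
    (E EL ER : V → V → (Matrix (Fin d) (Fin d) ℂ →ₗ[ℂ] Matrix (Fin d) (Fin d) ℂ))
    (hE : IsTOMOn Finset.univ E)
    (hL : IsTOMOn (Vm ∪ V0) EL) (hR : IsTOMOn (V0 ∪ Vp) ER)
    (hfac : tomAct E = (tomAct (extById Vp EL)) ∘ₗ (tomAct (extById Vm ER))) :
    ∀ ρ, DensityOn V0 ρ →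
      (returnProb E V0 ρ =
        (blockTrace (∑' n : ℕ, (retA EL V0 n) (∑' m : ℕ, (retA ER V0 m) ρ))).re) ∧
      ((∑' m : ℕ, (retA ER V0 m) ρ) ≠ 0 →
        returnProb E V0 ρ =
          returnProb EL V0
            ((blockTrace (∑' m : ℕ, (retA ER V0 m) ρ))⁻¹ •
              (∑' m : ℕ, (retA ER V0 m) ρ)) * returnProb ER V0 ρ) ∧
      (RecurrentOn EL V0 → returnProb E V0 ρ = returnProb ER V0 ρ) := by
  intro ρ hρ
  have hρpos : BlockPos ρ := hρ.1
  have h0R : V0 ⊆ V0 ∪ Vp := Finset.subset_union_left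
  have h0L : V0 ⊆ Vm ∪ V0 := Finset.subset_union_right
  have hsR := summable_retA h0R hR hρpos hρ.2.1
  set σ := ∑' m : ℕ, (retA ER V0 m) ρ with hσ
  have hσpos : BlockPos σ := BlockPos.tsum (fun n => hρpos.retA hR n) hsR
  have hσ0 : ∀ j ∉ V0, σ j = 0 := fun j hj => by
    rw [hσ, tsum_apply hsR]
    simp [retA_apply_of_notMem ER _ ρ hj]
  have hsL := summable_retA h0L hL hσpos hσ0
  have hπR : returnProb ER V0 ρ = (blockTrace σ).re := (hasSum_blockTrace_re hsR).tsum_eq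
  have hπL : returnProb E V0 ρ = returnProb EL V0 σ := by
    have hpos (a b : ℕ) := ((hρpos.retA (T := V0) hR b).retA (T := V0) hL a).blockTrace_re_nonneg
    have hinner (a : ℕ) : ∑' b, (blockTrace (retA EL V0 a (retA ER V0 b ρ))).re =
        (blockTrace (retA EL V0 a σ)).re := by
      have h := hsR.hasSum.map (retA EL V0 a) (LinearMap.continuous_of_finiteDimensional _)
      exact (hasSum_blockTrace_re h.summable).tsum_eq.trans
        (congrArg (fun x => (blockTrace x).re) h.tsum_eq)
    rw [returnProb, returnProb, ← tsum_congr hinner,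
      ← tsum_sum_antidiagonal_of_nonneg hpos
        (fun b N => sum_blockTrace_retA_le h0L hL (hρpos.retA hR b)
          (fun j hj => retA_apply_of_notMem ER b ρ hj) N)
        (hasSum_blockTrace_re hsR).summable]
    refine tsum_congr fun n => ?_
    rw [retA_eq_sum_antidiagonal hd1 hd2 hd3 hcover hL hR hfac, LinearMap.sum_apply]
    change (blockTraceₗ _).re = _
    rw [map_sum, Complex.re_sum]
    rfl
  have hreal : blockTrace σ = ((blockTrace σ).re : ℂ) :=
    Complex.eq_re_of_ofReal_le (r := 0) (by simpa using hσpos.blockTrace_nonneg)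
  have hne : σ ≠ 0 → (blockTrace σ).re ≠ 0 := fun h h' =>
    h (hσpos.eq_zero_of_blockTrace (by rw [hreal, h', Complex.ofReal_zero]))
  have hscale (h : σ ≠ 0) : returnProb E V0 ρ =
      returnProb EL V0 ((blockTrace σ)⁻¹ • σ) * returnProb ER V0 ρ := by
    rw [hreal, ← Complex.ofReal_inv, returnProb_smul, hπR, hπL]
    field_simp [hne h]
  refine ⟨hπL.trans (hasSum_blockTrace_re hsL).tsum_eq, hscale, fun hrec => ?_⟩
  by_cases h : σ = 0
  · rw [hπL, hπR, h]
    simp [returnProb, blockTrace]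
  · rw [hscale h, hrec, one_mul]
    refine ⟨fun j => Matrix.PosSemidef.smul (hσpos j) (a := (blockTrace σ)⁻¹) ?_,
      fun j hj => ?_, ?_⟩
    · rw [hreal, ← Complex.ofReal_inv]
      exact Complex.zero_le_real.2 (inv_nonneg.2 hσpos.blockTrace_re_nonneg)
    · simp [hσ0 j hj]
    · change blockTraceₗ _ = 1
      rw [_root_.map_smul]
      exact inv_mul_cancel₀ fun h' => hne h (by rw [h', Complex.zero_re])

end QMCTOM
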